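/- arXiv:2101.04217 — 2 statements merged into one kernel-verified Lean document; each statement's English description precedes it below -/
import Mathlib

section
/- Let s0 ≤ b with b ∈ I, and let f, g : I → ℂ belong to L²_β(s0,b), be continuous and differentiable at s0, and suppose D_β f and D_β g are bounded on the set {β^k(b) : k ∈ ℕ₀} ∪ {s0}. Then ⟨D_β f, g⟩ = f(b)·conj(g(β^{-1}(b))) − f(s0)·conj(g(s0)) + ⟨f, −(D_β β^{-1})·(D_{β^{-1}} g)⟩, where the inner products are taken over (s0,b). -/
open Function Set ComplexConjugate

/-- The β-derivative `D_β f` of `f : ℝ → ℂ`: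
`(f (β t) - f t) / (β t - t)` for `t ≠ s0`, and `f' s0` at `t = s0`. -/
noncomputable def Dq (β : ℝ → ℝ) (s0 : ℝ) (f : ℝ → ℂ) (t : ℝ) : ℂ :=
  if t = s0 then deriv f s0 else (f (β t) - f t) / ((β t : ℂ) - (t : ℂ))

/-- The β-integral `∫_{s0}^{x} f d_β = ∑_{k} (β^k x - β^{k+1} x) f (β^k x)` (complex-valued). -/
noncomputable def betaInt (β : ℝ → ℝ) (x : ℝ) (f : ℝ → ℂ) : ℂ :=
  ∑' k : ℕ, ((β^[k] x - β^[k + 1] x : ℝ) : ℂ) * f (β^[k] x)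

/-- The β-integral `∫_{s0}^{x} f d_β` for a real-valued integrand. -/
noncomputable def betaIntR (β : ℝ → ℝ) (x : ℝ) (f : ℝ → ℝ) : ℝ :=
  ∑' k : ℕ, (β^[k] x - β^[k + 1] x) * f (β^[k] x)

/-- `∫_a^b f d_β := ∫_{s0}^b f d_β - ∫_{s0}^a f d_β`. -/
noncomputable def betaIntAB (β : ℝ → ℝ) (a b : ℝ) (f : ℝ → ℂ) : ℂ :=
  betaInt β b f - betaInt β a f

/-- `∫_a^b f d_β` for a real-valued integrand. -/
noncomputable def betaIntRAB (β : ℝ → ℝ) (a b : ℝ) (f : ℝ → ℝ) : ℝ :=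
  betaIntR β b f - betaIntR β a f

/-- `D_β β⁻¹`, viewed as a complex-valued function. -/
noncomputable def DbinvC (β βinv : ℝ → ℝ) (s0 : ℝ) : ℝ → ℂ :=
  Dq β s0 fun u => (βinv u : ℂ)

/-- The β-Sturm–Liouville operator
`ℓ_β y (t) = -(D_β β⁻¹)(t) · (D_{β⁻¹} (D_β y))(t) + r t · y t`. -/
noncomputable def ellBeta (β βinv : ℝ → ℝ) (s0 : ℝ) (r : ℝ → ℝ) (y : ℝ → ℂ) (t : ℝ) : ℂ :=
  -(DbinvC β βinv s0 t) * Dq βinv s0 (Dq β s0 y) t + (r t : ℂ) * y t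

/-- The β-Wronskian `[y,z](t) = y t · (D_{β⁻¹} z) t - z t · (D_{β⁻¹} y) t`. -/
noncomputable def wronk (βinv : ℝ → ℝ) (s0 : ℝ) (y z : ℝ → ℂ) (t : ℝ) : ℂ :=
  y t * Dq βinv s0 z t - z t * Dq βinv s0 y t

/-- The β-exponential `e_{p,β}(t) = 1 / ∏_k (1 - p(β^k t)(β^k t - β^{k+1} t))`. -/
noncomputable def ebeta (β : ℝ → ℝ) (p : ℝ → ℂ) (t : ℝ) : ℂ :=
  1 / ∏' k : ℕ, (1 - p (β^[k] t) * ((β^[k] t - β^[k + 1] t : ℝ) : ℂ))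

/-- The β-exponential `E_{p,β}(t) = ∏_k (1 + p(β^k t)(β^k t - β^{k+1} t))`. -/
noncomputable def Ebeta (β : ℝ → ℝ) (p : ℝ → ℂ) (t : ℝ) : ℂ :=
  ∏' k : ℕ, (1 + p (β^[k] t) * ((β^[k] t - β^[k + 1] t : ℝ) : ℂ))

/-- `sin_{p,β}(t) = (e_{ip,β}(t) - e_{-ip,β}(t)) / (2i)`. -/
noncomputable def sinBeta (β : ℝ → ℝ) (p : ℝ → ℂ) (t : ℝ) : ℂ :=
  (ebeta β (fun s => Complex.I * p s) t - ebeta β (fun s => -(Complex.I * p s)) t) /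
    (2 * Complex.I)

/-- `cos_{p,β}(t) = (e_{ip,β}(t) + e_{-ip,β}(t)) / 2`. -/
noncomputable def cosBeta (β : ℝ → ℝ) (p : ℝ → ℂ) (t : ℝ) : ℂ :=
  (ebeta β (fun s => Complex.I * p s) t + ebeta β (fun s => -(Complex.I * p s)) t) / 2

open Filter Topology

/-- Abel summation for infinite series, in terms of the limits of the two sequences. -/
lemma tsum_sub_mul_eq_of_tendsto {F H : ℕ → ℂ} {a c : ℂ}
    (hF : Tendsto F atTop (𝓝 a)) (hH : Tendsto H atTop (𝓝 c))
    (hFs : Summable fun k => ‖F k - F (k + 1)‖) (hHs : Summable fun k => ‖H k - H (k + 1)‖) :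
    ∑' k, (F k - F (k + 1)) * H (k + 1) =
      F 0 * H 0 - a * c + ∑' k, F k * (H (k + 1) - H k) := by
  have h1 : Summable fun k => (F k - F (k + 1)) * H (k + 1) := by
    refine summable_of_isBigO_nat hFs ?_
    have hb := ((tendsto_add_atTop_iff_nat 1).2 hH).isBigO_one ℝ
    simpa using (Asymptotics.isBigO_refl (fun k => F k - F (k + 1)) atTop).norm_right.mul hb
  have h2 : Summable fun k => F k * (H (k + 1) - H k) := by
    refine summable_of_isBigO_nat hHs ?_
    have hb := (Asymptotics.isBigO_refl (fun k => H k - H (k + 1)) atTop).norm_right.neg_left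
    simpa using (hF.isBigO_one ℝ).mul hb
  have h3 := (h1.sub h2).hasSum.tendsto_sum_nat
  have h4 : ∀ n, ∑ k ∈ Finset.range n,
      ((F k - F (k + 1)) * H (k + 1) - F k * (H (k + 1) - H k)) = F 0 * H 0 - F n * H n := by
    intro n
    rw [← Finset.sum_range_sub' (fun k => F k * H k)]
    exact Finset.sum_congr rfl fun k _ => by ring
  simp only [h4] at h3
  have h5 := tendsto_nhds_unique h3 (tendsto_const_nhds.sub (hF.mul hH))
  rw [h1.tsum_sub h2] at h5
  linear_combination h5

/-- The increments of an antitone real sequence that is bounded below are summable. -/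
lemma Antitone.summable_sub_succ {x : ℕ → ℝ} (hx : Antitone x) {m : ℝ} (hm : ∀ k, m ≤ x k) :
    Summable fun k => x k - x (k + 1) := by
  refine summable_of_sum_range_le (c := x 0 - m) (fun k => sub_nonneg.2 (hx k.le_succ)) fun n => ?_
  rw [Finset.sum_range_sub']
  linarith [hm n]

section Orbit

variable {I : Set ℝ} {β : ℝ → ℝ} {s0 b : ℝ}

lemma lt_self_of_sign (hsign : ∀ t ∈ I, (t - s0) * (β t - t) ≤ 0)
    (huniq : ∀ t ∈ I, (t - s0) * (β t - t) = 0 → t = s0) {t : ℝ} (ht : t ∈ I) (h : s0 < t) :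
    β t < t := by
  have h1 := lt_of_le_of_ne (hsign t ht) fun h0 => h.ne' (huniq t ht h0)
  nlinarith

lemma iterate_mem_and_lt (hmono : StrictMonoOn β I) (hmaps : MapsTo β I I) (hs0I : s0 ∈ I)
    (hfix : β s0 = s0) (hb : b ∈ I) (hs0b : s0 < b) (k : ℕ) :
    β^[k] b ∈ I ∧ s0 < β^[k] b := by
  induction k with
  | zero => exact ⟨hb, hs0b⟩
  | succ k ih =>
    rw [iterate_succ_apply']
    exact ⟨hmaps ih.1, hfix ▸ hmono hs0I ih.1 ih.2⟩

lemma tendsto_iterate_fixedPoint (hI : I.OrdConnected) (hcont : ContinuousOn β I)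
    (huniq : ∀ t ∈ I, (t - s0) * (β t - t) = 0 → t = s0) (hs0I : s0 ∈ I) (hb : b ∈ I)
    (hmem : ∀ k : ℕ, β^[k] b ∈ I ∧ s0 < β^[k] b) (hanti : Antitone fun k : ℕ => β^[k] b) :
    Tendsto (fun k : ℕ => β^[k] b) atTop (𝓝 s0) := by
  have hbdd : BddBelow (range fun k : ℕ => β^[k] b) :=
    ⟨s0, by rintro _ ⟨k, rfl⟩; exact (hmem k).2.le⟩
  have hlim := tendsto_atTop_ciInf hanti hbdd
  set L := ⨅ k : ℕ, β^[k] b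
  have hLI : L ∈ I := hI.out hs0I hb ⟨le_ciInf fun k => (hmem k).2.le, ciInf_le hbdd 0⟩
  have h1 : Tendsto (fun k : ℕ => β (β^[k] b)) atTop (𝓝 (β L)) :=
    (hcont L hLI).tendsto.comp
      (tendsto_nhdsWithin_iff.2 ⟨hlim, Eventually.of_forall fun k => (hmem k).1⟩)
  have h2 := (tendsto_add_atTop_iff_nat 1).2 hlim
  simp only [iterate_succ_apply'] at h2
  have hL : β L = L := tendsto_nhds_unique h1 h2
  rwa [huniq L hLI (by rw [hL]; ring)] at hlim

/-- A function with bounded `β`-derivative along an orbit has summable increments there. -/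
lemma summable_norm_sub_of_Dq_le {x : ℕ → ℝ} (hx : ∀ k, x (k + 1) = β (x k))
    (hpos : ∀ k, s0 < x k) (hlt : ∀ k, x (k + 1) < x k) {f : ℝ → ℂ} {C : ℝ}
    (hC : ∀ k, ‖Dq β s0 f (x k)‖ ≤ C) :
    Summable fun k => ‖f (x k) - f (x (k + 1))‖ := by
  have hs := (antitone_nat_of_succ_le fun k => (hlt k).le).summable_sub_succ fun k => (hpos k).le
  refine Summable.of_nonneg_of_le (fun _ => norm_nonneg _) (fun k => ?_) (hs.mul_left C)
  have h := hC k
  have hd : 0 < x k - x (k + 1) := sub_pos.2 (hlt k)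
  rw [Dq, if_neg (hpos k).ne', ← hx, norm_div, ← Complex.ofReal_sub, Complex.norm_real,
    Real.norm_eq_abs, abs_sub_comm, abs_of_pos hd, div_le_iff₀ hd, norm_sub_rev] at h
  exact h

end Orbit

theorem stmt_2
    (I : Set ℝ) (hIconn : I.OrdConnected)
    (β βinv : ℝ → ℝ) (s0 : ℝ)
    (hmono : StrictMonoOn β I) (hcont : ContinuousOn β I)
    (hbij : Set.BijOn β I I) (hinv : Set.InvOn βinv β I I)
    (hs0I : s0 ∈ I) (hfix : β s0 = s0)
    (hsign : ∀ t ∈ I, (t - s0) * (β t - t) ≤ 0)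
    (huniq : ∀ t ∈ I, (t - s0) * (β t - t) = 0 → t = s0)
    (b : ℝ) (hb : b ∈ I) (hs0b : s0 ≤ b) (f g : ℝ → ℂ)
    (hfL2 : Summable fun j : ℕ => (β^[j] b - β^[j + 1] b) * ‖f (β^[j] b)‖ ^ 2)
    (hgL2 : Summable fun j : ℕ => (β^[j] b - β^[j + 1] b) * ‖g (β^[j] b)‖ ^ 2)
    (hfc : ContinuousAt f s0) (hgc : ContinuousAt g s0)
    (hfd : DifferentiableAt ℝ f s0) (hgd : DifferentiableAt ℝ g s0)
    (hfb : ∃ C, ∀ t ∈ insert s0 (Set.range fun j : ℕ => β^[j] b), ‖Dq β s0 f t‖ ≤ C)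
    (hgb : ∃ C, ∀ t ∈ insert s0 (Set.range fun j : ℕ => β^[j] b), ‖Dq β s0 g t‖ ≤ C) :
    betaInt β b (fun t => Dq β s0 f t * conj (g t)) =
      f b * conj (g (βinv b)) - f s0 * conj (g s0) +
        betaInt β b (fun t => f t * conj (-(DbinvC β βinv s0 t) * Dq βinv s0 g t)) := by
  rcases hs0b.eq_or_lt with rfl | hlt
  · have hfixinv : βinv s0 = s0 := by simpa [hfix] using hinv.1 hs0I
    simp [betaInt, iterate_fixed hfix, hfixinv]
  have hmem := iterate_mem_and_lt hmono hbij.mapsTo hs0I hfix hb hlt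
  have hsucc : ∀ k : ℕ, β^[k + 1] b = β (β^[k] b) := fun k => iterate_succ_apply' β k b
  have hdec : ∀ k : ℕ, β^[k + 1] b < β^[k] b := fun k => by
    rw [hsucc]
    exact lt_self_of_sign hsign huniq (hmem k).1 (hmem k).2
  have hlim := tendsto_iterate_fixedPoint hIconn hcont huniq hs0I hb hmem
    (antitone_nat_of_succ_le fun k => (hdec k).le)
  obtain ⟨Cf, hCf⟩ := hfb
  obtain ⟨Cg, hCg⟩ := hgb
  have hfs := summable_norm_sub_of_Dq_le hsucc (fun k => (hmem k).2) hdec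
    fun k => hCf _ (.inr ⟨k, rfl⟩)
  have hgs := summable_norm_sub_of_Dq_le hsucc (fun k => (hmem k).2) hdec
    fun k => hCg _ (.inr ⟨k, rfl⟩)
  obtain ⟨H, hH0, hH⟩ : ∃ H : ℕ → ℂ, (∀ k, H k = conj (g (βinv (β^[k] b)))) ∧
      ∀ k, H (k + 1) = conj (g (β^[k] b)) :=
    ⟨fun k => conj (g (βinv (β^[k] b))), fun _ => rfl, fun k => by
      simp only [hsucc, hinv.1 (hmem k).1]⟩
  have hHlim : Tendsto H atTop (𝓝 (conj (g s0))) := by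
    refine (tendsto_add_atTop_iff_nat 1).1 ?_
    simp only [hH]
    exact (Complex.continuous_conj.tendsto _).comp (hgc.tendsto.comp hlim)
  have hHs : Summable fun k => ‖H k - H (k + 1)‖ := by
    refine (summable_nat_add_iff 1).1 ?_
    simpa only [hH, ← map_sub, RCLike.norm_conj] using hgs
  have key := tsum_sub_mul_eq_of_tendsto (hfc.tendsto.comp hlim) hHlim hfs hHs
  simp only [comp_apply, iterate_zero, id_eq, hH0 0] at key
  have hne : ∀ k : ℕ, ((β (β^[k] b) : ℂ) - (β^[k] b : ℂ)) ≠ 0 := fun k => by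
    have := hdec k
    rw [hsucc] at this
    exact sub_ne_zero.2 (by exact_mod_cast this.ne)
  have hne' : ∀ k : ℕ, ((βinv (β^[k] b) : ℂ) - (β^[k] b : ℂ)) ≠ 0 := fun k => by
    refine sub_ne_zero.2 ?_
    norm_cast
    intro h
    have h1 := hinv.2 (hmem k).1
    rw [h, ← hsucc] at h1
    exact (hdec k).ne h1
  have hL : ∀ k : ℕ, ((β^[k] b - β^[k + 1] b : ℝ) : ℂ) *
      (Dq β s0 f (β^[k] b) * conj (g (β^[k] b))) =
      (f (β^[k] b) - f (β^[k + 1] b)) * H (k + 1) := fun k => by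
    have := hne k
    rw [Dq, if_neg (hmem k).2.ne', hH, hsucc]
    push_cast
    field_simp
    ring
  have hR : ∀ k : ℕ, ((β^[k] b - β^[k + 1] b : ℝ) : ℂ) * (f (β^[k] b) *
      conj (-(DbinvC β βinv s0 (β^[k] b)) * Dq βinv s0 g (β^[k] b))) =
      f (β^[k] b) * (H (k + 1) - H k) := fun k => by
    have h1 := hne k
    have h2 := hne' k
    rw [DbinvC, Dq, Dq, if_neg (hmem k).2.ne', if_neg (hmem k).2.ne', hH, hH0, hsucc,
      hinv.1 (hmem k).1]
    simp only [map_mul, map_neg, map_div₀, map_sub, Complex.conj_ofReal]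
    push_cast
    field_simp
    ring
  simp only [betaInt, hL, hR]
  exact key
end

section
/- (Self-adjointness on (s0,b).) Let s0 ≤ b with b ∈ I, let r : I → ℝ be continuous on [s0,b], and let a1, a2, b1, b2 be real numbers with |a1| + |a2| ≠ 0 and |b1| + |b2| ≠ 0. Let y, z : I → ℂ belong to L²_β(s0,b), be continuous and differentiable at s0, with D_β y and D_β z differentiable at s0 and D_β y, D_β z, D_{β^{-1}}D_β y, D_{β^{-1}}D_β z bounded on {β^k(b) : k ∈ ℕ₀} ∪ {s0}, and suppose both y and z satisfy the boundary conditions a1·w(s0) + a2·(D_{β^{-1}}w)(s0) = 0 and b1·w(b) + b2·(D_{β^{-1}}w)(b) = 0. Then ⟨ℓ_β y, z⟩ = ⟨y, ℓ_β z⟩, the inner products being taken over (s0,b). -/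
open Function Set ComplexConjugate

/-- The orbit of a point to the right of the fixed point decreases to the fixed point. -/
theorem orbit_props {I : Set ℝ} (hI : I.OrdConnected) {β : ℝ → ℝ} {s0 : ℝ}
    (hmono : StrictMonoOn β I) (hcont : ContinuousOn β I) (hmaps : Set.MapsTo β I I)
    (hs0 : s0 ∈ I) (hfix : β s0 = s0)
    (hsign : ∀ t ∈ I, (t - s0) * (β t - t) ≤ 0)
    (huniq : ∀ t ∈ I, (t - s0) * (β t - t) = 0 → t = s0)
    {u : ℝ} (hu : u ∈ I) (hs0u : s0 < u) :
    (∀ k, β^[k] u ∈ I) ∧ (∀ k, s0 < β^[k] u) ∧ (∀ k, β^[k + 1] u < β^[k] u) ∧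
      Filter.Tendsto (fun k => β^[k] u) Filter.atTop (nhds s0) := by
  have hmem : ∀ k, β^[k] u ∈ I := fun k => hmaps.iterate k hu
  have hgt : ∀ k, s0 < β^[k] u := by
    intro k
    induction k with
    | zero => simpa using hs0u
    | succ k ih =>
      rw [Function.iterate_succ_apply', ← hfix]
      exact hmono hs0 (hmem k) ih
  have hlt : ∀ k, β^[k + 1] u < β^[k] u := by
    intro k
    rw [Function.iterate_succ_apply']
    by_contra! h
    refine (hgt k).ne' (huniq _ (hmem k) (le_antisymm (hsign _ (hmem k)) ?_))
    exact mul_nonneg (sub_nonneg.2 (hgt k).le) (sub_nonneg.2 h)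
  refine ⟨hmem, hgt, hlt, ?_⟩
  have hanti : Antitone fun k => β^[k] u := antitone_nat_of_succ_le fun k => (hlt k).le
  have hbdd : BddBelow (Set.range fun k => β^[k] u) :=
    ⟨s0, by rintro _ ⟨k, rfl⟩; exact (hgt k).le⟩
  have hlim := tendsto_atTop_ciInf hanti hbdd
  set L := ⨅ k, β^[k] u
  have hL : L ∈ I := hI.out hs0 hu ⟨le_ciInf fun k => (hgt k).le, ciInf_le hbdd 0⟩
  have h1 : Filter.Tendsto (fun k => β (β^[k] u)) Filter.atTop (nhds (β L)) :=
    (hcont L hL).tendsto.comp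
      (tendsto_nhdsWithin_iff.2 ⟨hlim, Filter.Eventually.of_forall hmem⟩)
  have h2 : Filter.Tendsto (fun k => β (β^[k] u)) Filter.atTop (nhds L) := by
    simpa only [Function.comp_def, Function.iterate_succ_apply'] using
      hlim.comp (Filter.tendsto_add_atTop_nat 1)
  have h3 : β L = L := tendsto_nhds_unique h1 h2
  rwa [huniq L hL (by rw [h3, sub_self, mul_zero])] at hlim

/-- Two functions satisfying the same real separated boundary condition have vanishing
sesquilinear boundary form. -/
theorem boundary_form_eq_zero {a1 a2 : ℝ} (h : |a1| + |a2| ≠ 0) {y y' z z' : ℂ}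
    (hy : (a1 : ℂ) * y + (a2 : ℂ) * y' = 0) (hz : (a1 : ℂ) * z + (a2 : ℂ) * z' = 0) :
    y * conj z' - y' * conj z = 0 := by
  have hz' : (a1 : ℂ) * conj z + (a2 : ℂ) * conj z' = 0 := by
    simpa using congrArg conj hz
  by_cases h1 : a1 = 0
  · have h2 : (a2 : ℂ) ≠ 0 := by
      rintro h2
      exact h (by simp [h1, Complex.ofReal_eq_zero.1 h2])
    refine (mul_eq_zero.1 ?_).resolve_left h2
    linear_combination y * hz' - conj z * hy
  · refine (mul_eq_zero.1 ?_).resolve_left (Complex.ofReal_ne_zero.2 h1)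
    linear_combination conj z' * hy - y' * hz'

/-- If `f - g` has sum zero then `f` and `g` have the same unconditional sum. -/
theorem tsum_eq_of_hasSum_sub_zero {f g : ℕ → ℂ} (h : HasSum (fun k => f k - g k) 0) :
    ∑' k, f k = ∑' k, g k := by
  by_cases hg : Summable g
  · have := h.add hg.hasSum
    simp only [sub_add_cancel, zero_add] at this
    exact this.tsum_eq
  · have hf : ¬ Summable f := fun hf => hg (by simpa using hf.sub h.summable)
    rw [tsum_eq_zero_of_not_summable hf, tsum_eq_zero_of_not_summable hg]

/-- The successive differences of a bounded-below antitone real sequence are summable. -/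
theorem summable_sub_succ {X : ℕ → ℝ} {l : ℝ} (hX : ∀ k, X (k + 1) ≤ X k) (hl : ∀ k, l ≤ X k) :
    Summable fun k => X k - X (k + 1) := by
  refine summable_of_sum_range_le (c := X 0 - l) (fun k => sub_nonneg.2 (hX k)) fun n => ?_
  rw [Finset.sum_range_sub']
  linarith [hl n]

theorem stmt_7
    (I : Set ℝ) (hIconn : I.OrdConnected)
    (β βinv : ℝ → ℝ) (s0 : ℝ)
    (hmono : StrictMonoOn β I) (hcont : ContinuousOn β I)
    (hbij : Set.BijOn β I I) (hinv : Set.InvOn βinv β I I)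
    (hs0I : s0 ∈ I) (hfix : β s0 = s0)
    (hsign : ∀ t ∈ I, (t - s0) * (β t - t) ≤ 0)
    (huniq : ∀ t ∈ I, (t - s0) * (β t - t) = 0 → t = s0)
    (b : ℝ) (hb : b ∈ I) (hs0b : s0 ≤ b)
    (r : ℝ → ℝ) (hr : ContinuousOn r (Set.Icc s0 b))
    (a1 a2 b1 b2 : ℝ) (ha12 : |a1| + |a2| ≠ 0) (hb12 : |b1| + |b2| ≠ 0) (y z : ℝ → ℂ)
    (hyL2 : Summable fun j : ℕ => (β^[j] b - β^[j + 1] b) * ‖y (β^[j] b)‖ ^ 2)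
    (hzL2 : Summable fun j : ℕ => (β^[j] b - β^[j + 1] b) * ‖z (β^[j] b)‖ ^ 2)
    (hyc : ContinuousAt y s0) (hzc : ContinuousAt z s0)
    (hyd : DifferentiableAt ℝ y s0) (hzd : DifferentiableAt ℝ z s0)
    (hDyd : DifferentiableAt ℝ (Dq β s0 y) s0) (hDzd : DifferentiableAt ℝ (Dq β s0 z) s0)
    (hDyb : ∃ C, ∀ t ∈ insert s0 (Set.range fun j : ℕ => β^[j] b), ‖Dq β s0 y t‖ ≤ C)
    (hDzb : ∃ C, ∀ t ∈ insert s0 (Set.range fun j : ℕ => β^[j] b), ‖Dq β s0 z t‖ ≤ C)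
    (hDDyb : ∃ C, ∀ t ∈ insert s0 (Set.range fun j : ℕ => β^[j] b), ‖Dq βinv s0 (Dq β s0 y) t‖ ≤ C)
    (hDDzb : ∃ C, ∀ t ∈ insert s0 (Set.range fun j : ℕ => β^[j] b), ‖Dq βinv s0 (Dq β s0 z) t‖ ≤ C)
    (hybc1 : (a1 : ℂ) * y s0 + (a2 : ℂ) * Dq βinv s0 y s0 = 0)
    (hybc2 : (b1 : ℂ) * y b + (b2 : ℂ) * Dq βinv s0 y b = 0)
    (hzbc1 : (a1 : ℂ) * z s0 + (a2 : ℂ) * Dq βinv s0 z s0 = 0)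
    (hzbc2 : (b1 : ℂ) * z b + (b2 : ℂ) * Dq βinv s0 z b = 0) :
    betaInt β b (fun t => ellBeta β βinv s0 r y t * conj (z t)) =
      betaInt β b (fun t => y t * conj (ellBeta β βinv s0 r z t)) := by
  rcases hs0b.eq_or_lt with rfl | hlt
  · have hit : ∀ k, β^[k] s0 = s0 := fun k => Function.iterate_fixed hfix k
    simp [betaInt, hit]
  obtain ⟨u, hu, hub⟩ := hbij.surjOn hb
  have hs0u : s0 < u := by
    rw [← hmono.lt_iff_lt hs0I hu, hfix, hub]
    exact hlt
  obtain ⟨hmem, hgt, hdec, hlim⟩ :=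
    orbit_props hIconn hmono hcont hbij.mapsTo hs0I hfix hsign huniq hu hs0u
  have hit : ∀ k, β^[k] b = β^[k + 1] u := fun k => by rw [Function.iterate_succ_apply, hub]
  obtain ⟨X, hX⟩ : ∃ X : ℕ → ℝ, ∀ k, β^[k] u = X k := ⟨_, fun _ => rfl⟩
  have hβ : ∀ k, β (X k) = X (k + 1) := fun k => by
    rw [← hX, ← hX, Function.iterate_succ_apply']
  have hX1 : X 1 = b := by rw [← hX]; exact hub
  simp only [hX] at hmem hgt hdec hlim hit
  have hβinv : ∀ k, βinv (X (k + 1)) = X k := fun k => by rw [← hβ, hinv.1 (hmem k)]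
  have hne : ∀ k, X k ≠ s0 := fun k => (hgt k).ne'
  have hd : ∀ k, (X k : ℂ) - X (k + 1) ≠ 0 := fun k => by
    rw [← Complex.ofReal_sub, Complex.ofReal_ne_zero]
    exact (sub_pos.2 (hdec k)).ne'
  have hd' : ∀ k, (X (k + 1) : ℂ) - X k ≠ 0 := fun k => by
    rw [← neg_sub, neg_ne_zero]
    exact hd k
  have hDq : ∀ (w : ℝ → ℂ) k,
      w (X (k + 1)) = w (X k) - (X k - X (k + 1)) * Dq β s0 w (X k) := fun w k => by
    have := hd' k
    rw [Dq, if_neg (hne k), hβ]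
    field_simp
    ring
  have hDD : ∀ (w : ℝ → ℂ) k, Dq β s0 w (X k) - Dq β s0 w (X (k + 1)) =
      (X k - X (k + 1)) * Dq βinv s0 (Dq β s0 w) (X (k + 1)) := fun w k => by
    rw [Dq.eq_def βinv, if_neg (hne _), hβinv, mul_div_cancel₀ _ (hd k)]
  have hDb : ∀ k, ((X (k + 1) : ℂ) - X (k + 2)) * DbinvC β βinv s0 (X (k + 1)) =
      ((X k - X (k + 1) : ℝ) : ℂ) := fun k => by
    have := hd' (k + 1)
    rw [DbinvC, Dq, if_neg (hne _), hβ, hβinv, hβinv, Complex.ofReal_sub]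
    field_simp
    ring
  have hDb' : ∀ k, ((X (k + 1) : ℂ) - X (k + 2)) * conj (DbinvC β βinv s0 (X (k + 1))) =
      ((X k - X (k + 1) : ℝ) : ℂ) := fun k => by
    have := congrArg conj (hDb k)
    simpa only [map_mul, map_sub, Complex.conj_ofReal] using this
  obtain ⟨Cy, hCy⟩ := hDDyb
  obtain ⟨Cz, hCz⟩ := hDDzb
  have horb : ∀ k, X (k + 1) ∈ insert s0 (Set.range fun j : ℕ => β^[j] b) := fun k =>
    Or.inr ⟨k, hit k⟩
  have hlim1 := hlim.comp (Filter.tendsto_add_atTop_nat 1)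
  have hylim := hyc.tendsto.comp hlim1
  have hzlim := hzc.tendsto.comp hlim1
  have hpylim := hDyd.continuousAt.tendsto.comp hlim
  have hpzlim := hDzd.continuousAt.tendsto.comp hlim
  obtain ⟨My, hMy⟩ := hylim.norm.bddAbove_range
  obtain ⟨Mz, hMz⟩ := hzlim.norm.bddAbove_range
  have hMy' : ∀ k, ‖y (X (k + 1))‖ ≤ My := fun k => hMy ⟨k, rfl⟩
  have hMz' : ∀ k, ‖z (X (k + 1))‖ ≤ Mz := fun k => hMz ⟨k, rfl⟩
  -- the boundary form along the orbit, through which the difference of the integrands telescopes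
  let W : ℕ → ℂ := fun k =>
    y (X (k + 1)) * conj (Dq β s0 z (X k)) - Dq β s0 y (X k) * conj (z (X (k + 1)))
  have hWdiff : ∀ k, W k - W (k + 1) = ((X k - X (k + 1) : ℝ) : ℂ) *
      (y (X (k + 1)) * conj (Dq βinv s0 (Dq β s0 z) (X (k + 1))) -
        Dq βinv s0 (Dq β s0 y) (X (k + 1)) * conj (z (X (k + 1)))) := fun k => by
    have e1 := hDq y (k + 1)
    have e2 := congrArg conj (hDq z (k + 1))
    have e3 := hDD y k
    have e4 := congrArg conj (hDD z k)
    simp only [map_mul, map_sub, Complex.conj_ofReal] at e2 e4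
    simp only [W, Complex.ofReal_sub]
    rw [e1, e2]
    linear_combination y (X (k + 1)) * e4 - conj (z (X (k + 1))) * e3
  have hDqs0 : ∀ w, Dq βinv s0 w s0 = Dq β s0 w s0 := fun w => by simp [Dq]
  have hDqb : ∀ w, Dq βinv s0 w b = Dq β s0 w (X 0) := fun w => by
    rw [Dq, Dq, if_neg hlt.ne', if_neg (hne 0), hβ, ← hX1, hβinv, ← neg_sub (w (X 1)),
      ← neg_sub (X (0 + 1) : ℂ), neg_div_neg_eq]
  have hWlim : Filter.Tendsto W Filter.atTop (nhds 0) := by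
    rw [hDqs0] at hybc1 hzbc1
    rw [← boundary_form_eq_zero ha12 hybc1 hzbc1]
    exact (hylim.mul ((Complex.continuous_conj.tendsto _).comp hpzlim)).sub
      (hpylim.mul ((Complex.continuous_conj.tendsto _).comp hzlim))
  have hW0 : W 0 = 0 := by
    rw [hDqb] at hybc2 hzbc2
    simp only [W, zero_add, hX1]
    exact boundary_form_eq_zero hb12 hybc2 hzbc2
  have hWsum : Summable fun k => W k - W (k + 1) := by
    refine Summable.of_norm_bounded
      ((summable_sub_succ (fun k => (hdec k).le) fun k => (hgt k).le).mul_right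
        (My * Cz + Cy * Mz)) fun k => ?_
    rw [hWdiff, norm_mul, Complex.norm_real, Real.norm_of_nonneg (sub_pos.2 (hdec k)).le]
    refine mul_le_mul_of_nonneg_left ?_ (sub_pos.2 (hdec k)).le
    refine (norm_sub_le _ _).trans ?_
    rw [norm_mul, norm_mul, RCLike.norm_conj, RCLike.norm_conj]
    exact add_le_add
      (mul_le_mul (hMy' k) (hCz _ (horb k)) (norm_nonneg _) ((norm_nonneg _).trans (hMy' k)))
      (mul_le_mul (hCy _ (horb k)) (hMz' k) (norm_nonneg _)
        ((norm_nonneg _).trans (hCy _ (horb k))))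
  have hWhas : HasSum (fun k => W k - W (k + 1)) 0 := by
    rw [hWsum.hasSum_iff_tendsto_nat]
    simp only [Finset.sum_range_sub', hW0]
    simpa using hWlim.neg
  unfold betaInt
  refine tsum_eq_of_hasSum_sub_zero ?_
  convert hWhas using 2 with k
  rw [hWdiff, hit, hit]
  simp only [ellBeta, map_add, map_mul, map_neg, Complex.conj_ofReal, Complex.ofReal_sub]
  have e1 := hDb k
  have e2 := hDb' k
  rw [Complex.ofReal_sub] at e1 e2
  linear_combination
    -(Dq βinv s0 (Dq β s0 y) (X (k + 1)) * conj (z (X (k + 1)))) * e1 +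
      y (X (k + 1)) * conj (Dq βinv s0 (Dq β s0 z) (X (k + 1))) * e2
end
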